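/- Let M be an irreducible generator on a finite set Z with |Z| ≥ 2 and let ζ ∈ P_+(Z). Let ζ_* = min_z ζ(z) and M_* = min { M(z,z') : z ≠ z', M(z,z') > 0 }. Then the generalised log-Sobolev constant satisfies the chain of lower bounds α_gLSI(ζ,M) ≥ 2 α_sLSI(M^ζ) ≥ α_gPI(ζ,M) / (1 + (1/2) log(1/ζ_*)) ≥ (ζ_* M_* / |Z|) / (1 + (1/2) log(1/ζ_*)); in particular α_gLSI(ζ,M) > 0. -/

import Mathlib

open Finset Filter

/-- A generator (transition rate matrix) on a finite state space `Z`. -/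
def IsGenerator {Z : Type*} [Fintype Z] (M : Z → Z → ℝ) : Prop :=
  (∀ z z' : Z, z ≠ z' → 0 ≤ M z z') ∧ ∀ z : Z, ∑ z' : Z, M z z' = 0

/-- Irreducibility of a generator. -/
def IsIrreducibleGen {Z : Type*} [Fintype Z] (M : Z → Z → ℝ) : Prop :=
  ∀ z z' : Z, z ≠ z' → ∃ (ℓ : ℕ) (p : ℕ → Z), 1 ≤ ℓ ∧ p 0 = z ∧ p ℓ = z' ∧
    ∀ i : ℕ, 1 ≤ i → i ≤ ℓ → 0 < M (p (i - 1)) (p i)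

/-- A probability measure on `Z`. -/
def IsProb {Z : Type*} [Fintype Z] (ζ : Z → ℝ) : Prop :=
  (∀ z, 0 ≤ ζ z) ∧ ∑ z : Z, ζ z = 1

/-- A strictly positive probability measure on `Z`. -/
def IsPosProb {Z : Type*} [Fintype Z] (ζ : Z → ℝ) : Prop :=
  (∀ z, 0 < ζ z) ∧ ∑ z : Z, ζ z = 1

/-- Expectation of `f` with respect to `ζ`. -/
noncomputable def expec {Z : Type*} [Fintype Z] (ζ f : Z → ℝ) : ℝ := ∑ z : Z, f z * ζ z

/-- Variance of `f` with respect to `ζ`. -/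
noncomputable def varWrt {Z : Type*} [Fintype Z] (ζ f : Z → ℝ) : ℝ :=
  expec ζ (fun z => f z ^ 2) - (expec ζ f) ^ 2

/-- Generalised Dirichlet form with respect to `ζ`. -/
noncomputable def dirichletForm {Z : Type*} [Fintype Z] (ζ f : Z → ℝ) (M : Z → Z → ℝ) : ℝ :=
  (1 / 2) * ∑ z : Z, ∑ z' : Z, M z z' * ζ z * (f z - f z') ^ 2

/-- A (strictly positive) probability density with respect to `ζ`. -/
def IsDensity {Z : Type*} [Fintype Z] (ζ φ : Z → ℝ) : Prop :=
  (∀ z, 0 < φ z) ∧ expec ζ φ = 1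

/-- Relative entropy with respect to `ζ`. -/
noncomputable def relEnt {Z : Type*} [Fintype Z] (ζ φ : Z → ℝ) : ℝ :=
  ∑ z : Z, φ z * Real.log (φ z) * ζ z

/-- Generalised Fisher information with respect to `ζ`. -/
noncomputable def fisherInfo {Z : Type*} [Fintype Z] (ζ φ : Z → ℝ) (M : Z → Z → ℝ) : ℝ :=
  ∑ z : Z, ∑ z' : Z, M z z' * ζ z * φ z * (φ z' / φ z - 1 - Real.log (φ z' / φ z))

/-- `f` is a nonconstant function. -/
def Nonconst {Z : Type*} (f : Z → ℝ) : Prop := ∃ z z' : Z, f z ≠ f z'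

/-- Generalised Poincaré constant. -/
noncomputable def gPI {Z : Type*} [Fintype Z] (ζ : Z → ℝ) (M : Z → Z → ℝ) : ℝ :=
  sInf { r : ℝ | ∃ f : Z → ℝ, Nonconst f ∧ r = dirichletForm ζ f M / varWrt ζ f }

/-- Generalised log-Sobolev constant. -/
noncomputable def gLSI {Z : Type*} [Fintype Z] (ζ : Z → ℝ) (M : Z → Z → ℝ) : ℝ :=
  sInf { r : ℝ | ∃ φ : Z → ℝ, IsDensity ζ φ ∧ φ ≠ (fun _ => 1) ∧
    r = fisherInfo ζ φ M / relEnt ζ φ }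

/-- The `ζ`-symmetrised generator `M^ζ`. -/
noncomputable def symGen {Z : Type*} [Fintype Z] [DecidableEq Z]
    (ζ : Z → ℝ) (M : Z → Z → ℝ) : Z → Z → ℝ :=
  fun z z' =>
    if z' = z then
      -∑ w ∈ Finset.univ.erase z, (1 / 2) * (M z w + ζ w / ζ z * M w z)
    else (1 / 2) * (M z z' + ζ z' / ζ z * M z' z)

/-- The centred entropy with respect to `ζ`. -/
noncomputable def centEnt {Z : Type*} [Fintype Z] (ζ g : Z → ℝ) : ℝ :=
  relEnt ζ g - expec ζ g * Real.log (expec ζ g)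

/-- The standard log-Sobolev constant of a generator `A` with respect to the
weight `ζ`. -/
noncomputable def sLSI {Z : Type*} [Fintype Z] (ζ : Z → ℝ) (A : Z → Z → ℝ) : ℝ :=
  sInf { r : ℝ | ∃ f : Z → ℝ, (∀ z, 0 < f z) ∧ Nonconst f ∧
    r = dirichletForm ζ f A / centEnt ζ (fun z => f z ^ 2) }

/-- The minimal value of `ζ`. -/
noncomputable def minVal {Z : Type*} (ζ : Z → ℝ) : ℝ := sInf (Set.range ζ)

/-- The smallest positive off-diagonal rate of `M`. -/
noncomputable def minPosRate {Z : Type*} (M : Z → Z → ℝ) : ℝ :=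
  sInf { x : ℝ | ∃ z z' : Z, z ≠ z' ∧ 0 < M z z' ∧ x = M z z' }

lemma minPosRate_le {Z : Type*} {M : Z → Z → ℝ} {z z' : Z} (hne : z ≠ z') (h : 0 < M z z') :
    minPosRate M ≤ M z z' :=
  csInf_le ⟨0, by rintro x ⟨a, b, -, hab, rfl⟩; exact hab.le⟩ ⟨z, z', hne, h, rfl⟩

lemma Nonconst.exists_ne {Z : Type*} {f : Z → ℝ} (hf : Nonconst f) (c : ℝ) : ∃ z, f z ≠ c := by
  by_contra! h
  obtain ⟨a, b, hab⟩ := hf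
  exact hab ((h a).trans (h b).symm)

lemma exists_pos_nonconst {Z : Type*} [Nontrivial Z] :
    ∃ f : Z → ℝ, (∀ z, 0 < f z) ∧ Nonconst f := by
  classical
  obtain ⟨a, b, hab⟩ := exists_pair_ne Z
  refine ⟨fun z => if z = a then 1 else 2, fun z => by dsimp only; split_ifs <;> norm_num,
    a, b, ?_⟩
  simp [hab.symm]

section Weights

variable {Z : Type*} [Fintype Z] {ζ : Z → ℝ}

lemma minVal_le (z : Z) : minVal ζ ≤ ζ z :=
  csInf_le (Set.finite_range ζ).bddBelow ⟨z, rfl⟩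

lemma minVal_pos [Nonempty Z] (hζ : ∀ z, 0 < ζ z) : 0 < minVal ζ := by
  obtain ⟨z, hz⟩ := (Set.range_nonempty ζ).csInf_mem (Set.finite_range ζ)
  unfold minVal
  rw [← hz]
  exact hζ z

lemma minVal_le_one [Nonempty Z] (hζ : IsPosProb ζ) : minVal ζ ≤ 1 := by
  obtain ⟨z⟩ := ‹Nonempty Z›
  refine (minVal_le z).trans ?_
  rw [← hζ.2]
  exact single_le_sum (fun w _ => (hζ.1 w).le) (mem_univ z)

lemma minPosRate_pos {M : Z → Z → ℝ} {z z' : Z} (hne : z ≠ z') (h : 0 < M z z') :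
    0 < minPosRate M := by
  have hfin : { x : ℝ | ∃ z z' : Z, z ≠ z' ∧ 0 < M z z' ∧ x = M z z' }.Finite := by
    refine (Set.finite_range (fun p : Z × Z => M p.1 p.2)).subset ?_
    rintro x ⟨a, b, -, -, rfl⟩
    exact ⟨(a, b), rfl⟩
  obtain ⟨a, b, -, hab, heq⟩ :=
    Set.Nonempty.csInf_mem (s := { x : ℝ | ∃ z z' : Z, z ≠ z' ∧ 0 < M z z' ∧ x = M z z' })
      ⟨_, z, z', hne, h, rfl⟩ hfin
  unfold minPosRate
  rw [heq]
  exact hab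

lemma expec_pos [Nonempty Z] (hζ : IsPosProb ζ) {g : Z → ℝ} (hg : ∀ z, 0 < g z) :
    0 < expec ζ g :=
  sum_pos (fun z _ => mul_pos (hg z) (hζ.1 z)) univ_nonempty

lemma sum_sub_expec (hζ : IsPosProb ζ) (f : Z → ℝ) :
    ∑ z, (f z - expec ζ f) * ζ z = 0 := by
  simp only [sub_mul, sum_sub_distrib, ← mul_sum, hζ.2]
  simp [expec]

lemma varWrt_eq_sum (hζ : IsPosProb ζ) (f : Z → ℝ) :
    varWrt ζ f = ∑ z, (f z - expec ζ f) ^ 2 * ζ z := by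
  have h : ∀ z, (f z - expec ζ f) ^ 2 * ζ z
      = f z ^ 2 * ζ z - 2 * expec ζ f * (f z * ζ z) + expec ζ f ^ 2 * ζ z := fun z => by ring
  simp only [h, sum_add_distrib, sum_sub_distrib, ← mul_sum, hζ.2]
  unfold varWrt
  simp only [expec]
  ring

lemma varWrt_pos (hζ : IsPosProb ζ) {f : Z → ℝ} (hf : Nonconst f) : 0 < varWrt ζ f := by
  rw [varWrt_eq_sum hζ]
  obtain ⟨z, hz⟩ := hf.exists_ne (expec ζ f)
  refine sum_pos' (fun w _ => mul_nonneg (sq_nonneg _) (hζ.1 w).le) ⟨z, mem_univ z, ?_⟩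
  exact mul_pos (sq_pos_of_ne_zero (sub_ne_zero.2 hz)) (hζ.1 z)

/-- Popoviciu's inequality. -/
lemma varWrt_le_sq_div_four (hζ : IsPosProb ζ) {f : Z → ℝ} {a b : ℝ}
    (ha : ∀ z, a ≤ f z) (hb : ∀ z, f z ≤ b) : varWrt ζ f ≤ (b - a) ^ 2 / 4 := by
  have h : 0 ≤ ∑ z, (b - f z) * (f z - a) * ζ z := sum_nonneg fun z _ =>
    mul_nonneg (mul_nonneg (sub_nonneg.2 (hb z)) (sub_nonneg.2 (ha z))) (hζ.1 z).le
  have h' : ∀ z, (b - f z) * (f z - a) * ζ z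
      = (a + b) * (f z * ζ z) - f z ^ 2 * ζ z - a * b * ζ z := fun z => by ring
  simp only [h', sum_sub_distrib, ← mul_sum, hζ.2] at h
  change 0 ≤ (a + b) * expec ζ f - expec ζ (fun z => f z ^ 2) - a * b * 1 at h
  unfold varWrt
  nlinarith [sq_nonneg (expec ζ f - (a + b) / 2)]

lemma centEnt_pos [Nonempty Z] (hζ : IsPosProb ζ) {g : Z → ℝ} (hg : ∀ z, 0 < g z)
    (hne : Nonconst g) : 0 < centEnt ζ g := by
  set c := expec ζ g with hc
  have hc0 : 0 < c := expec_pos hζ hg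
  have key : ∀ z, g z ≠ c → g z - c < g z * Real.log (g z) - g z * Real.log c := by
    intro z hz
    have h1 := Real.log_lt_sub_one_of_pos (div_pos hc0 (hg z))
      (by rw [Ne, div_eq_one_iff_eq (hg z).ne']; exact hz.symm)
    rw [Real.log_div hc0.ne' (hg z).ne'] at h1
    have h2 := mul_lt_mul_of_pos_left h1 (hg z)
    have h3 : g z * (c / g z - 1) = c - g z := by
      have := (hg z).ne'
      field_simp
    rw [h3] at h2
    linarith
  obtain ⟨w, hw⟩ := hne.exists_ne c
  have h : ∑ z, (g z - c) * ζ z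
      < ∑ z, (g z * Real.log (g z) - g z * Real.log c) * ζ z := by
    refine sum_lt_sum (fun z _ => mul_le_mul_of_nonneg_right ?_ (hζ.1 z).le)
      ⟨w, mem_univ w, mul_lt_mul_of_pos_right (key w hw) (hζ.1 w)⟩
    by_cases hz : g z = c
    · simp [hz]
    · exact (key z hz).le
  rw [hc, sum_sub_expec hζ, ← hc] at h
  have h' : ∀ z, (g z * Real.log (g z) - g z * Real.log c) * ζ z
      = g z * Real.log (g z) * ζ z - Real.log c * (g z * ζ z) := fun z => by ring
  simp only [h', sum_sub_distrib, ← mul_sum] at h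
  change 0 < relEnt ζ g - Real.log c * expec ζ g at h
  unfold centEnt
  rw [← hc] at h ⊢
  linarith

/-- Rothaus' lemma combined with the crude bound of an entropy by a second moment. -/
lemma centEnt_sq_le [Nonempty Z] (hζ : IsPosProb ζ) {s : ℝ} (hs : 0 < s) (hsζ : ∀ z, s ≤ ζ z)
    {f : Z → ℝ} (hf : ∀ z, 0 < f z) :
    centEnt ζ (fun z => f z ^ 2) ≤ (2 + Real.log (1 / s)) * varWrt ζ f := by
  set L := Real.log (1 / s) with hL
  set m := expec ζ f with hm
  set v := varWrt ζ f with hv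
  set h : Z → ℝ := fun z => f z - m with hh
  have hm0 : 0 < m := expec_pos hζ hf
  have hv' : v = ∑ z, h z ^ 2 * ζ z := varWrt_eq_sum hζ f
  have hh0 : ∑ z, h z * ζ z = 0 := sum_sub_expec hζ f
  have hv0 : 0 ≤ v := by
    rw [hv']
    exact sum_nonneg fun z _ => mul_nonneg (sq_nonneg _) (hζ.1 z).le
  have hpos : ∀ t ∈ Set.Icc (0 : ℝ) 1, ∀ z, 0 < m + t * h z := by
    intro t ht z
    have e : m + t * h z = (1 - t) * m + t * f z := by simp only [hh]; ring
    rw [e]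
    rcases ht.1.eq_or_lt with rfl | ht0
    · simpa using hm0
    · have := mul_pos ht0 (hf z)
      have := mul_nonneg (sub_nonneg.2 ht.2) hm0.le
      linarith
  have hcpos : ∀ t : ℝ, 0 < m ^ 2 + t ^ 2 * v := fun t => by positivity
  have hmom : ∀ t : ℝ, ∑ z, (m + t * h z) ^ 2 * ζ z = m ^ 2 + t ^ 2 * v := by
    intro t
    have e : ∀ z, (m + t * h z) ^ 2 * ζ z
        = m ^ 2 * ζ z + 2 * m * t * (h z * ζ z) + t ^ 2 * (h z ^ 2 * ζ z) := fun z => by ring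
    simp only [e, sum_add_distrib, ← mul_sum, hζ.2, hh0, ← hv']
    ring
  have hlog : ∀ t ∈ Set.Icc (0 : ℝ) 1, ∀ z,
      2 * Real.log (m + t * h z) ≤ Real.log (m ^ 2 + t ^ 2 * v) + L := by
    intro t ht z
    have hp := hpos t ht z
    rw [hL, ← Real.log_mul (hcpos t).ne' (by positivity)]
    have e : 2 * Real.log (m + t * h z) = Real.log ((m + t * h z) ^ 2) := by
      rw [Real.log_pow]; norm_num
    rw [e]
    refine Real.log_le_log (by positivity) ?_
    rw [mul_one_div, le_div_iff₀ hs, ← hmom]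
    calc (m + t * h z) ^ 2 * s ≤ (m + t * h z) ^ 2 * ζ z :=
          mul_le_mul_of_nonneg_left (hsζ z) (sq_nonneg _)
      _ ≤ _ := single_le_sum (f := fun z => (m + t * h z) ^ 2 * ζ z)
          (fun w _ => mul_nonneg (sq_nonneg _) (hζ.1 w).le) (mem_univ z)
  let F : ℝ → ℝ := fun t => (2 + L) * v * t ^ 2 -
    (∑ z, 2 * (m + t * h z) ^ 2 * Real.log (m + t * h z) * ζ z
      - (m ^ 2 + t ^ 2 * v) * Real.log (m ^ 2 + t ^ 2 * v))
  let G : ℝ → ℝ := fun t => 2 * (2 + L) * v * t -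
    (∑ z, 4 * h z * (m + t * h z) * Real.log (m + t * h z) * ζ z
      - 2 * t * v * Real.log (m ^ 2 + t ^ 2 * v))
  let G' : ℝ → ℝ := fun t => 2 * (2 + L) * v -
    (∑ z, (4 * h z ^ 2 * Real.log (m + t * h z) + 4 * h z ^ 2) * ζ z
      - (2 * v * Real.log (m ^ 2 + t ^ 2 * v)
        + 2 * t * v * (2 * t * v / (m ^ 2 + t ^ 2 * v))))
  have hlin : ∀ (z : Z) (t : ℝ), HasDerivAt (fun t => m + t * h z) (h z) t := fun z t => by
    simpa using ((hasDerivAt_id t).mul_const (h z)).const_add m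
  have hquad : ∀ t : ℝ, HasDerivAt (fun t => m ^ 2 + t ^ 2 * v) (2 * t * v) t := fun t => by
    simpa using ((hasDerivAt_pow 2 t).mul_const v).const_add (m ^ 2)
  have hF : ∀ t ∈ Set.Icc (0 : ℝ) 1, HasDerivAt F (G t) t := by
    intro t ht
    have h1 : HasDerivAt
        (fun t => ∑ z, 2 * (m + t * h z) ^ 2 * Real.log (m + t * h z) * ζ z)
        (∑ z, (4 * h z * (m + t * h z) * Real.log (m + t * h z) * ζ z
          + 2 * (m * (h z * ζ z) + t * (h z ^ 2 * ζ z)))) t := by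
      refine HasDerivAt.fun_sum fun z _ => ?_
      have hp := (hpos t ht z).ne'
      refine (((((hlin z t).fun_pow 2).const_mul 2).fun_mul
        ((hlin z t).log hp)).mul_const (ζ z)).congr_deriv ?_
      field_simp
      ring
    have h2 := (hquad t).fun_mul ((hquad t).log (hcpos t).ne')
    have h3 : HasDerivAt (fun t : ℝ => (2 + L) * v * t ^ 2) ((2 + L) * v * (2 * t)) t := by
      simpa using (hasDerivAt_pow 2 t).const_mul ((2 + L) * v)
    refine (h3.fun_sub (h1.fun_sub h2)).congr_deriv ?_
    simp only [G, sum_add_distrib, ← mul_sum, hh0, ← hv']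
    have := (hcpos t).ne'
    field_simp
    ring
  have hG : ∀ t ∈ Set.Icc (0 : ℝ) 1, HasDerivAt G (G' t) t := by
    intro t ht
    have h1 : HasDerivAt
        (fun t => ∑ z, 4 * h z * (m + t * h z) * Real.log (m + t * h z) * ζ z)
        (∑ z, (4 * h z ^ 2 * Real.log (m + t * h z) + 4 * h z ^ 2) * ζ z) t := by
      refine HasDerivAt.fun_sum fun z _ => ?_
      have hp := (hpos t ht z).ne'
      refine ((((hlin z t).const_mul (4 * h z)).fun_mul
        ((hlin z t).log hp)).mul_const (ζ z)).congr_deriv ?_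
      have e : (m + t * h z) * (h z / (m + t * h z)) = h z := mul_div_cancel₀ (h z) hp
      rw [mul_assoc (4 * h z) (m + t * h z) (h z / (m + t * h z)), e]
      ring
    have h2 : HasDerivAt (fun t : ℝ => 2 * t * v) (2 * v) t := by
      simpa using ((hasDerivAt_id t).const_mul 2).mul_const v
    have h3 : HasDerivAt (fun t : ℝ => 2 * (2 + L) * v * t) (2 * (2 + L) * v) t := by
      simpa using (hasDerivAt_id t).const_mul (2 * (2 + L) * v)
    exact h3.fun_sub (h1.fun_sub (h2.fun_mul ((hquad t).log (hcpos t).ne')))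
  have hG' : ∀ t ∈ Set.Icc (0 : ℝ) 1, 0 ≤ G' t := by
    intro t ht
    have h1 : ∑ z, (4 * h z ^ 2 * Real.log (m + t * h z) + 4 * h z ^ 2) * ζ z
        ≤ ∑ z, (2 * (Real.log (m ^ 2 + t ^ 2 * v) + L) + 4) * (h z ^ 2 * ζ z) := by
      refine sum_le_sum fun z _ => ?_
      have := mul_le_mul_of_nonneg_right (hlog t ht z)
        (mul_nonneg (sq_nonneg (h z)) (hζ.1 z).le)
      nlinarith
    rw [← mul_sum, ← hv'] at h1
    have h2 : 0 ≤ 2 * t * v * (2 * t * v / (m ^ 2 + t ^ 2 * v)) := by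
      have := ht.1
      have := hcpos t
      positivity
    simp only [G']
    linarith
  have hGmono : MonotoneOn G (Set.Icc 0 1) := by
    refine monotoneOn_of_deriv_nonneg (convex_Icc 0 1)
      (fun t ht => (hG t ht).continuousAt.continuousWithinAt)
      (fun t ht => (hG t (interior_subset ht)).differentiableAt.differentiableWithinAt)
      fun t ht => ?_
    rw [(hG t (interior_subset ht)).deriv]
    exact hG' t (interior_subset ht)
  have hG0 : G 0 = 0 := by
    have e : ∀ z, 4 * h z * m * Real.log m * ζ z = 4 * m * Real.log m * (h z * ζ z) :=
      fun z => by ring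
    simp [G, e, ← mul_sum, hh0]
  have hFmono : MonotoneOn F (Set.Icc 0 1) := by
    refine monotoneOn_of_deriv_nonneg (convex_Icc 0 1)
      (fun t ht => (hF t ht).continuousAt.continuousWithinAt)
      (fun t ht => (hF t (interior_subset ht)).differentiableAt.differentiableWithinAt)
      fun t ht => ?_
    rw [(hF t (interior_subset ht)).deriv, ← hG0]
    exact hGmono ⟨le_rfl, zero_le_one⟩ (interior_subset ht) (interior_subset ht).1
  have hF0 : F 0 = 0 := by
    simp [F, ← mul_sum, hζ.2]
    ring
  have hF1 := hFmono ⟨le_rfl, zero_le_one⟩ ⟨zero_le_one, le_rfl⟩ zero_le_one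
  have hsum : ∑ z, 2 * (m + 1 * h z) ^ 2 * Real.log (m + 1 * h z) * ζ z
      = relEnt ζ (fun z => f z ^ 2) := by
    refine sum_congr rfl fun z _ => ?_
    have e : m + 1 * h z = f z := by simp only [hh]; ring
    rw [e, Real.log_pow]
    push_cast
    ring
  have hE : m ^ 2 + 1 ^ 2 * v = expec ζ (fun z => f z ^ 2) := by
    simp only [hv, varWrt, ← hm]
    ring
  rw [hF0] at hF1
  simp only [F, hsum, hE] at hF1
  unfold centEnt
  linarith

lemma dirichletForm_nonneg {M : Z → Z → ℝ} (hM : ∀ z z' : Z, z ≠ z' → 0 ≤ M z z')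
    (hζ : ∀ z, 0 < ζ z) (f : Z → ℝ) : 0 ≤ dirichletForm ζ f M := by
  refine mul_nonneg (by norm_num) (sum_nonneg fun z _ => sum_nonneg fun z' _ => ?_)
  by_cases h : z = z'
  · simp [h]
  · exact mul_nonneg (mul_nonneg (hM z z' h) (hζ z).le) (sq_nonneg _)

lemma dirichletForm_symGen [DecidableEq Z] (hζ : ∀ z, 0 < ζ z) (f : Z → ℝ) (M : Z → Z → ℝ) :
    dirichletForm ζ f (symGen ζ M) = dirichletForm ζ f M := by
  have e : ∀ z z', symGen ζ M z z' * ζ z * (f z - f z') ^ 2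
      = 1 / 2 * (M z z' * ζ z * (f z - f z') ^ 2)
        + 1 / 2 * (M z' z * ζ z' * (f z' - f z) ^ 2) := by
    intro z z'
    by_cases h : z' = z
    · simp [h]
    · have := (hζ z).ne'
      simp only [symGen, h, if_false]
      field_simp
      ring
  unfold dirichletForm
  simp only [e, sum_add_distrib, ← mul_sum]
  rw [sum_comm (f := fun z z' => M z' z * ζ z' * (f z' - f z) ^ 2)]
  ring

lemma two_mul_dirichletForm_sqrt_le_fisherInfo {M : Z → Z → ℝ}
    (hM : ∀ z z' : Z, z ≠ z' → 0 ≤ M z z') (hζ : ∀ z, 0 < ζ z) {φ : Z → ℝ}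
    (hφ : ∀ z, 0 < φ z) :
    2 * dirichletForm ζ (fun z => √(φ z)) M ≤ fisherInfo ζ φ M := by
  unfold dirichletForm fisherInfo
  rw [← mul_assoc, mul_one_div_cancel two_ne_zero, one_mul]
  refine sum_le_sum fun z _ => sum_le_sum fun z' _ => ?_
  by_cases h : z = z'
  · subst h
    simp [(hφ z).ne']
  rw [mul_assoc _ (φ z)]
  refine mul_le_mul_of_nonneg_left ?_ (mul_nonneg (hM z z' h) (hζ z).le)
  obtain ⟨a, ha, hza⟩ : ∃ a, 0 < a ∧ φ z = a ^ 2 :=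
    ⟨√(φ z), Real.sqrt_pos.2 (hφ z), (Real.sq_sqrt (hφ z).le).symm⟩
  obtain ⟨b, hb, hzb⟩ : ∃ b, 0 < b ∧ φ z' = b ^ 2 :=
    ⟨√(φ z'), Real.sqrt_pos.2 (hφ z'), (Real.sq_sqrt (hφ z').le).symm⟩
  dsimp only
  rw [hza, hzb, Real.sqrt_sq ha.le, Real.sqrt_sq hb.le, ← div_pow, Real.log_pow]
  have h1 := Real.log_le_sub_one_of_pos (div_pos hb ha)
  have h2 : (a - b) ^ 2 = a ^ 2 * ((b / a) ^ 2 - 1 - 2 * (b / a - 1)) := by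
    field_simp
    ring
  rw [h2]
  push_cast
  gcongr

/-- A shortest path in an irreducible generator visits no state twice. -/
lemma IsIrreducibleGen.exists_injOn_path {M : Z → Z → ℝ} (hirr : IsIrreducibleGen M) (z z' : Z) :
    ∃ (ℓ : ℕ) (p : ℕ → Z), p 0 = z ∧ p ℓ = z' ∧ (∀ i < ℓ, 0 < M (p i) (p (i + 1))) ∧
      Set.InjOn p (Set.Iic ℓ) := by
  classical
  have hex : ∃ (ℓ : ℕ), ∃ p : ℕ → Z, p 0 = z ∧ p ℓ = z' ∧ ∀ i < ℓ, 0 < M (p i) (p (i + 1)) := by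
    by_cases h : z = z'
    · exact ⟨0, fun _ => z, rfl, h, fun i hi => absurd hi (Nat.not_lt_zero i)⟩
    · obtain ⟨ℓ, p, -, h0, h1, h2⟩ := hirr z z' h
      exact ⟨ℓ, p, h0, h1, fun i hi => by simpa using h2 (i + 1) (by omega) (by omega)⟩
  obtain ⟨p, h0, h1, h2⟩ := Nat.find_spec hex
  refine ⟨Nat.find hex, p, h0, h1, h2, ?_⟩
  have key : ∀ i j, i < j → j ≤ Nat.find hex → p i ≠ p j := by
    intro i j hij hj heq
    refine Nat.find_min hex (m := Nat.find hex - (j - i)) (by omega)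
      ⟨fun k => if k ≤ i then p k else p (k + (j - i)), by simpa using h0, ?_, ?_⟩
    · dsimp only
      split_ifs with hk
      · have e : j = Nat.find hex := by omega
        have e' : Nat.find hex - (j - i) = i := by omega
        rw [e', heq]
        exact (congrArg p e).trans h1
      · rw [Nat.sub_add_cancel (by omega), h1]
    · intro k hk
      dsimp only
      rcases lt_trichotomy k i with hki | rfl | hki
      · rw [if_pos hki.le, if_pos (by omega)]
        exact h2 k (by omega)
      · rw [if_pos le_rfl, if_neg (by omega), heq]
        have e : k + 1 + (j - k) = j + 1 := by omega
        rw [e]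
        exact h2 j (by omega)
      · rw [if_neg (by omega), if_neg (by omega)]
        have e : k + 1 + (j - i) = k + (j - i) + 1 := by omega
        rw [e]
        exact h2 _ (by omega)
  intro i hi j hj heq
  rcases lt_trichotomy i j with h | h | h
  · exact absurd heq (key i j h hj)
  · exact h
  · exact absurd heq.symm (key j i h hi)

lemma sq_sub_le_dirichletForm {M : Z → Z → ℝ} (hM : ∀ z z' : Z, z ≠ z' → 0 ≤ M z z')
    (hirr : IsIrreducibleGen M) (hζ : ∀ z, 0 < ζ z) {s r : ℝ} (hs : 0 ≤ s) (hr : 0 ≤ r)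
    (hsζ : ∀ z, s ≤ ζ z) (hrM : ∀ z z', z ≠ z' → 0 < M z z' → r ≤ M z z') (f : Z → ℝ) (a b : Z) :
    s * r * (f a - f b) ^ 2 ≤ Fintype.card Z * (2 * dirichletForm ζ f M) := by
  classical
  obtain ⟨ℓ, p, rfl, rfl, hp, hinj⟩ := hirr.exists_injOn_path a b
  have hinj' : Set.InjOn p (range ℓ) := hinj.mono fun i hi => by
    simp only [coe_range, Set.mem_Iio] at hi
    exact hi.le
  have hcard : ℓ ≤ Fintype.card Z := by
    rw [← card_range ℓ, ← card_image_of_injOn hinj']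
    exact card_le_univ _
  have hnn : ∀ z z', 0 ≤ M z z' * ζ z * (f z - f z') ^ 2 := by
    intro z z'
    by_cases h : z = z'
    · simp [h]
    · exact mul_nonneg (mul_nonneg (hM z z' h) (hζ z).le) (sq_nonneg _)
  have hedge : ∀ i ∈ range ℓ, s * r * (f (p i) - f (p (i + 1))) ^ 2
      ≤ ∑ z', M (p i) z' * ζ (p i) * (f (p i) - f z') ^ 2 := by
    intro i hi
    rw [mem_range] at hi
    have hne : p i ≠ p (i + 1) := fun h => by
      have := hinj (Set.mem_Iic.2 hi.le) (Set.mem_Iic.2 hi) h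
      omega
    refine le_trans ?_ (single_le_sum
      (f := fun z' => M (p i) z' * ζ (p i) * (f (p i) - f z') ^ 2)
      (fun z' _ => hnn (p i) z') (mem_univ (p (i + 1))))
    refine mul_le_mul_of_nonneg_right ?_ (sq_nonneg _)
    rw [mul_comm]
    exact mul_le_mul (hrM _ _ hne (hp i hi)) (hsζ _) hs (hM _ _ hne)
  have hsum : ∑ i ∈ range ℓ, s * r * (f (p i) - f (p (i + 1))) ^ 2
      ≤ 2 * dirichletForm ζ f M := by
    unfold dirichletForm
    rw [← mul_assoc, mul_one_div_cancel two_ne_zero, one_mul]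
    refine (sum_le_sum hedge).trans ?_
    rw [← sum_image (f := fun z => ∑ z', M z z' * ζ z * (f z - f z') ^ 2) hinj']
    exact sum_le_sum_of_subset_of_nonneg (subset_univ _)
      fun z _ _ => sum_nonneg fun z' _ => hnn z z'
  have htel : f (p 0) - f (p ℓ) = ∑ i ∈ range ℓ, (f (p i) - f (p (i + 1))) :=
    (sum_range_sub' (fun i => f (p i)) ℓ).symm
  have hcs : (f (p 0) - f (p ℓ)) ^ 2
      ≤ ℓ * ∑ i ∈ range ℓ, (f (p i) - f (p (i + 1))) ^ 2 := by
    rw [htel]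
    simpa using sq_sum_le_card_mul_sum_sq (s := range ℓ) (f := fun i => f (p i) - f (p (i + 1)))
  have hcard' : (ℓ : ℝ) ≤ Fintype.card Z := by exact_mod_cast hcard
  rw [← mul_sum] at hsum
  calc s * r * (f (p 0) - f (p ℓ)) ^ 2
      ≤ s * r * (ℓ * ∑ i ∈ range ℓ, (f (p i) - f (p (i + 1))) ^ 2) :=
        mul_le_mul_of_nonneg_left hcs (mul_nonneg hs hr)
    _ = ℓ * (s * r * ∑ i ∈ range ℓ, (f (p i) - f (p (i + 1))) ^ 2) := by ring
    _ ≤ ℓ * (2 * dirichletForm ζ f M) := mul_le_mul_of_nonneg_left hsum (Nat.cast_nonneg ℓ)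
    _ ≤ _ := mul_le_mul_of_nonneg_right hcard'
        (mul_nonneg zero_le_two (dirichletForm_nonneg hM hζ f))

lemma gPI_mul_varWrt_le {M : Z → Z → ℝ} (hM : ∀ z z' : Z, z ≠ z' → 0 ≤ M z z')
    (hζ : IsPosProb ζ) {f : Z → ℝ} (hf : Nonconst f) :
    gPI ζ M * varWrt ζ f ≤ dirichletForm ζ f M := by
  rw [← le_div_iff₀ (varWrt_pos hζ hf)]
  refine csInf_le ⟨0, ?_⟩ ⟨f, hf, rfl⟩
  rintro x ⟨g, hg, rfl⟩
  exact div_nonneg (dirichletForm_nonneg hM hζ.1 g) (varWrt_pos hζ hg).le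

lemma minVal_mul_minPosRate_div_le_gPI [Nontrivial Z] {M : Z → Z → ℝ}
    (hM : ∀ z z' : Z, z ≠ z' → 0 ≤ M z z') (hirr : IsIrreducibleGen M)
    (hr : 0 ≤ minPosRate M) (hζ : IsPosProb ζ) :
    minVal ζ * minPosRate M / (Fintype.card Z : ℝ) ≤ gPI ζ M := by
  obtain ⟨f, -, hf⟩ := exists_pos_nonconst (Z := Z)
  refine le_csInf ⟨_, f, hf, rfl⟩ ?_
  rintro x ⟨g, hg, rfl⟩
  obtain ⟨a, ha⟩ := Finite.exists_max g
  obtain ⟨b, hb⟩ := Finite.exists_min g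
  have hs := (minVal_pos hζ.1).le
  have h1 := sq_sub_le_dirichletForm hM hirr hζ.1 hs hr minVal_le
    (fun _ _ => minPosRate_le) g a b
  have h2 := mul_le_mul_of_nonneg_left (varWrt_le_sq_div_four hζ hb ha) (mul_nonneg hs hr)
  have hc : (0 : ℝ) < Fintype.card Z := by exact_mod_cast Fintype.card_pos
  have h3 := mul_nonneg hc.le (dirichletForm_nonneg hM hζ.1 g)
  rw [le_div_iff₀ (varWrt_pos hζ hg), div_mul_eq_mul_div, div_le_iff₀ hc]
  linarith

lemma gPI_div_le_two_mul_sLSI [Nontrivial Z] [DecidableEq Z] {M : Z → Z → ℝ}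
    (hM : ∀ z z' : Z, z ≠ z' → 0 ≤ M z z') (hgPI : 0 ≤ gPI ζ M) (hζ : IsPosProb ζ) :
    gPI ζ M / (1 + (1 / 2) * Real.log (1 / minVal ζ)) ≤ 2 * sLSI ζ (symGen ζ M) := by
  have hL : 0 ≤ Real.log (1 / minVal ζ) :=
    Real.log_nonneg ((one_le_div (minVal_pos hζ.1)).2 (minVal_le_one hζ))
  set L := Real.log (1 / minVal ζ) with hLdef
  suffices h : gPI ζ M / (2 + L) ≤ sLSI ζ (symGen ζ M) by
    have e : gPI ζ M / (1 + (1 / 2) * L) = 2 * (gPI ζ M / (2 + L)) := by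
      field_simp
    linarith
  obtain ⟨f, hf, hf'⟩ := exists_pos_nonconst (Z := Z)
  refine le_csInf ⟨_, f, hf, hf', rfl⟩ ?_
  rintro x ⟨g, hg, ⟨a, b, hab⟩, rfl⟩
  have hE : 0 < centEnt ζ (fun z => g z ^ 2) := by
    refine centEnt_pos hζ (fun z => pow_pos (hg z) 2) ⟨a, b, fun h => hab ?_⟩
    exact (pow_left_inj₀ (hg a).le (hg b).le two_ne_zero).1 h
  rw [dirichletForm_symGen hζ.1, le_div_iff₀ hE, div_mul_eq_mul_div, div_le_iff₀ (by positivity)]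
  have h1 := mul_le_mul_of_nonneg_left
    (centEnt_sq_le hζ (minVal_pos hζ.1) minVal_le hg) hgPI
  have h2 := mul_le_mul_of_nonneg_right (gPI_mul_varWrt_le hM hζ ⟨a, b, hab⟩)
    (by positivity : 0 ≤ 2 + L)
  rw [← hLdef] at h1
  linarith

lemma two_mul_sLSI_le_gLSI [Nontrivial Z] [DecidableEq Z] {M : Z → Z → ℝ}
    (hM : ∀ z z' : Z, z ≠ z' → 0 ≤ M z z') (hζ : IsPosProb ζ) :
    2 * sLSI ζ (symGen ζ M) ≤ gLSI ζ M := by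
  refine le_csInf ?_ ?_
  · obtain ⟨f, hf, a, b, hab⟩ := exists_pos_nonconst (Z := Z)
    have hm := expec_pos hζ hf
    refine ⟨_, fun z => f z / expec ζ f, ⟨fun z => div_pos (hf z) hm, ?_⟩, fun h => hab ?_, rfl⟩
    · have e : ∀ z, f z / expec ζ f * ζ z = f z * ζ z / expec ζ f := fun z => by ring
      rw [expec]
      simp only [e, ← sum_div]
      exact div_self hm.ne'
    · have h1 := congrFun h a
      have h2 := congrFun h b
      exact (div_left_inj' hm.ne').1 (h1.trans h2.symm)
  · rintro x ⟨φ, ⟨hφ, hφ1⟩, hne, rfl⟩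
    have hnc : Nonconst φ := by
      by_contra h
      simp only [Nonconst, not_exists, not_not] at h
      refine hne (funext fun z => ?_)
      rw [← hφ1, expec, ← mul_one (φ z), ← hζ.2, mul_sum]
      exact sum_congr rfl fun w _ => by rw [h z w]
    have hent : centEnt ζ φ = relEnt ζ φ := by simp [centEnt, hφ1]
    have hpos := centEnt_pos hζ hφ hnc
    have hsq : (fun z => √(φ z) ^ 2) = φ := funext fun z => Real.sq_sqrt (hφ z).le
    have hle : sLSI ζ (symGen ζ M) ≤ dirichletForm ζ (fun z => √(φ z)) M / centEnt ζ φ := by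
      refine csInf_le ⟨0, ?_⟩ ⟨fun z => √(φ z), fun z => Real.sqrt_pos.2 (hφ z), ?_, ?_⟩
      · rintro y ⟨g, hg, ⟨a, b, hab⟩, rfl⟩
        rw [dirichletForm_symGen hζ.1]
        refine div_nonneg (dirichletForm_nonneg hM hζ.1 g)
          (centEnt_pos hζ (fun z => pow_pos (hg z) 2) ⟨a, b, fun h => hab ?_⟩).le
        exact (pow_left_inj₀ (hg a).le (hg b).le two_ne_zero).1 h
      · obtain ⟨a, b, hab⟩ := hnc
        exact ⟨a, b, fun h => hab ((Real.sqrt_inj (hφ a).le (hφ b).le).1 h)⟩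
      · rw [dirichletForm_symGen hζ.1, hsq]
    rw [le_div_iff₀ hpos] at hle
    rw [← hent, le_div_iff₀ hpos]
    have := two_mul_dirichletForm_sqrt_le_fisherInfo hM hζ.1 hφ
    linarith

end Weights

/-- chain of lower bounds for the generalised log-Sobolev
constant; in particular it is strictly positive. -/
theorem gLSI_lower_bounds
    {Z : Type*} [Fintype Z] [DecidableEq Z] (hcard : 2 ≤ Fintype.card Z)
    (M : Z → Z → ℝ) (hgen : IsGenerator M) (hirr : IsIrreducibleGen M)
    (ζ : Z → ℝ) (hζ : IsPosProb ζ) :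
    2 * sLSI ζ (symGen ζ M) ≤ gLSI ζ M ∧
      gPI ζ M / (1 + (1 / 2) * Real.log (1 / minVal ζ)) ≤ 2 * sLSI ζ (symGen ζ M) ∧
      (minVal ζ * minPosRate M / (Fintype.card Z : ℝ)) /
          (1 + (1 / 2) * Real.log (1 / minVal ζ)) ≤
        gPI ζ M / (1 + (1 / 2) * Real.log (1 / minVal ζ)) ∧
      0 < gLSI ζ M := by
  have : Nontrivial Z := Fintype.one_lt_card_iff_nontrivial.1 hcard
  obtain ⟨z, z', hne, hzz'⟩ : ∃ z z', z ≠ z' ∧ 0 < M z z' := by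
    obtain ⟨a, b, hab⟩ := exists_pair_ne Z
    obtain ⟨ℓ, p, rfl, rfl, hp, hinj⟩ := hirr.exists_injOn_path a b
    have hℓ : 0 < ℓ := Nat.pos_of_ne_zero fun h => hab (by rw [h])
    refine ⟨p 0, p 1, fun h => ?_, hp 0 hℓ⟩
    exact zero_ne_one (hinj (Set.mem_Iic.2 hℓ.le) (Set.mem_Iic.2 hℓ) h)
  have hr : 0 < minPosRate M := minPosRate_pos hne hzz'
  have hs : 0 < minVal ζ := minVal_pos hζ.1
  have hc : (0 : ℝ) < Fintype.card Z := by exact_mod_cast Fintype.card_pos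
  have hL : 0 ≤ Real.log (1 / minVal ζ) :=
    Real.log_nonneg ((one_le_div hs).2 (minVal_le_one hζ))
  have hden : 0 < 1 + (1 / 2) * Real.log (1 / minVal ζ) := by positivity
  have h3 := minVal_mul_minPosRate_div_le_gPI hgen.1 hirr hr.le hζ
  have hgPI : 0 < gPI ζ M := (div_pos (mul_pos hs hr) hc).trans_le h3
  have h1 := two_mul_sLSI_le_gLSI hgen.1 hζ
  have h2 := gPI_div_le_two_mul_sLSI hgen.1 hgPI.le hζ
  exact ⟨h1, h2, div_le_div_of_nonneg_right h3 hden.le,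
    (div_pos hgPI hden).trans_le (h2.trans h1)⟩
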